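/- arXiv:2111.01842 — 2 statements merged into one kernel-verified Lean document; each statement's English description precedes it below -/
import Mathlib

section
/- The optimal value of the Wasserstein distributionally robust problem min_{w∈ℝ^d} sup_{P∈P_{ρ,κ}} E^P[g(b aᵀ w)] equals the optimal value of the convex program: minimize over (w, λ, u, v, s, t) the quantity ρλ + (1/n) Σ_{i=1}^n s_i, subject to u_i = b_i a_iᵀ w, v_i = −u_i, t_i = 2κλ + s_i, g(u_i) ≤ s_i, and g(v_i) ≤ t_i for all i ∈ [n], together with ‖w‖_* ≤ λ/M. -/
open scoped RealInnerProductSpace BigOperators ENNReal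
open MeasureTheory

/-- Convex conjugate of an extended-real-valued function on `ℝ`. -/
noncomputable def econj (g : ℝ → EReal) (θ : ℝ) : EReal :=
  ⨆ x : ℝ, ((θ * x : ℝ) : EReal) - g x

/-- Truncation of an extended real to `ℝ≥0∞`. -/
noncomputable def erealToENNReal (x : EReal) : ℝ≥0∞ :=
  if x = ⊤ then ⊤ else ENNReal.ofReal x.toReal

/-- Expectation of an extended-real-valued function, as an extended real
(positive part minus negative part). -/
noncomputable def erealExp {α : Type} [MeasurableSpace α] (P : Measure α)
    (h : α → EReal) : EReal :=
  ((∫⁻ z, erealToENNReal (h z) ∂P : ℝ≥0∞) : EReal)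
    - ((∫⁻ z, erealToENNReal (-(h z)) ∂P : ℝ≥0∞) : EReal)


theorem aux_econj_lt {g : ℝ → EReal} {θ K : ℝ} (hgbot : ∀ x, g x ≠ ⊥)
    (h : ∀ x, ((θ * x - K : ℝ) : EReal) ≤ g x) : econj g θ < ⊤ := by
  have : econj g θ ≤ (K : EReal) := by
    refine iSup_le fun x => ?_
    have hx := h x
    have hb := hgbot x
    revert hx hb
    induction g x using EReal.rec with
    | bot => intro _ hb; exact absurd rfl hb
    | top => intro _ _; simp
    | coe r =>
      intro hx _
      have hx' : θ * x - K ≤ r := by exact_mod_cast hx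
      have : θ * x - r ≤ K := by linarith
      exact_mod_cast this
  exact lt_of_le_of_lt this (EReal.coe_lt_top K)

theorem aux_minorant {g : ℝ → EReal} {θ : ℝ} (hgbot : ∀ x, g x ≠ ⊥)
    (hgproper : ∃ x, g x ≠ ⊤) (h : econj g θ < ⊤) :
    ∃ K : ℝ, ∀ x, ((θ * x - K : ℝ) : EReal) ≤ g x := by
  have hle : ∀ x, ((θ * x : ℝ) : EReal) - g x ≤ econj g θ := fun x =>
    le_iSup (fun x : ℝ => ((θ * x : ℝ) : EReal) - g x) x
  revert h hle
  induction econj g θ using EReal.rec with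
  | top => intro h; exact absurd h (lt_irrefl _)
  | bot =>
    intro _ hle
    obtain ⟨x, hx⟩ := hgproper
    have h1 := hle x
    have h2 := hgbot x
    revert hx h1 h2
    induction g x using EReal.rec with
    | bot => intro _ _ h; exact absurd rfl h
    | top => intro h; exact absurd rfl h
    | coe r =>
      intro _ h1 _
      have : ((θ * x - r : ℝ) : EReal) ≤ ⊥ := by exact_mod_cast h1
      simp at this
      exact absurd this (EReal.coe_ne_bot _)
  | coe K =>
    intro _ hle
    refine ⟨K, fun x => ?_⟩
    have h1 := hle x
    have h2 := hgbot x
    revert h1 h2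
    induction g x using EReal.rec with
    | bot => intro _ h; exact absurd rfl h
    | top => intro _ _; simp
    | coe r =>
      intro h1 _
      have h1' : θ * x - r ≤ K := by exact_mod_cast h1
      have : θ * x - K ≤ r := by linarith
      exact_mod_cast this

theorem aux_between {g : ℝ → EReal} (hgbot : ∀ x, g x ≠ ⊥)
    (hgconv : ∀ x y t : ℝ, 0 ≤ t → t ≤ 1 →
      g (t * x + (1 - t) * y) ≤ (t : EReal) * g x + ((1 - t : ℝ) : EReal) * g y)
    {x y z : ℝ} (hxy : x < y) (hyz : y < z) (hx : g x ≠ ⊤) (hz : g z ≠ ⊤) : g y ≠ ⊤ := by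
  have h := hgconv x z ((z - y) / (z - x)) (div_nonneg (by linarith) (by linarith))
    ((div_le_one (by linarith)).2 (by linarith))
  have hzx : z - x ≠ 0 := by linarith
  have e : (z - y) / (z - x) * x + (1 - (z - y) / (z - x)) * z = y := by
    field_simp
    ring
  rw [e] at h
  lift g x to ℝ using ⟨hx, hgbot x⟩ with r
  lift g z to ℝ using ⟨hz, hgbot z⟩ with s
  intro hy
  rw [hy] at h
  rw [← EReal.coe_mul, ← EReal.coe_mul, ← EReal.coe_add] at h
  exact absurd (top_le_iff.1 h) (EReal.coe_ne_top _)

theorem aux_finite {g : ℝ → EReal}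
    (hgproper : ∃ x, g x ≠ ⊤) (hgbot : ∀ x, g x ≠ ⊥)
    (hgconv : ∀ x y t : ℝ, 0 ≤ t → t ≤ 1 →
      g (t * x + (1 - t) * y) ≤ (t : EReal) * g x + ((1 - t : ℝ) : EReal) * g y)
    {M : ℝ} (hub : ∀ θ, econj g θ < ⊤ → |θ| ≤ M)
    {θ0 K : ℝ} (hθ0 : |θ0| ≤ M) (hK : ∀ x, ((θ0 * x - K : ℝ) : EReal) ≤ g x) (x1 : ℝ) :
    g x1 ≠ ⊤ := by
  intro h1
  obtain ⟨x0, h0⟩ := hgproper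
  have hne : x0 ≠ x1 := by rintro rfl; exact h0 h1
  rw [abs_le] at hθ0
  rcases lt_or_gt_of_ne hne with hlt | hlt
  · have : econj g (M + 1) < ⊤ := by
      refine aux_econj_lt (K := (M + 1 - θ0) * x1 + K) hgbot fun z => ?_
      by_cases hz : g z = ⊤
      · rw [hz]; exact le_top
      have hz1 : z ≤ x1 := by
        by_contra hc
        exact aux_between hgbot hgconv hlt (not_le.1 hc) h0 hz h1
      refine le_trans ?_ (hK z)
      rw [EReal.coe_le_coe_iff]
      nlinarith
    have := hub _ this
    rw [abs_le] at this
    linarith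
  · have : econj g (-M - 1) < ⊤ := by
      refine aux_econj_lt (K := (-M - 1 - θ0) * x1 + K) hgbot fun z => ?_
      by_cases hz : g z = ⊤
      · rw [hz]; exact le_top
      have hz1 : x1 ≤ z := by
        by_contra hc
        exact aux_between hgbot hgconv (not_le.1 hc) hlt hz h0 h1
      refine le_trans ?_ (hK z)
      rw [EReal.coe_le_coe_iff]
      nlinarith
    have := hub _ this
    rw [abs_le] at this
    linarith

theorem aux_lip {f : ℝ → ℝ}
    (hconv : ∀ x y t : ℝ, 0 ≤ t → t ≤ 1 →
      f (t * x + (1 - t) * y) ≤ t * f x + (1 - t) * f y)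
    {M : ℝ} (hub : ∀ θ K : ℝ, (∀ x, θ * x - K ≤ f x) → |θ| ≤ M)
    {θ0 K : ℝ} (hK : ∀ x, θ0 * x - K ≤ f x) (x y : ℝ) (hxy : x < y) :
    |f x - f y| ≤ M * |x - y| := by
  have h3 : ∀ a b c : ℝ, a < b → b < c → f b * (c - a) ≤ (c - b) * f a + (b - a) * f c := by
    intro a b c hab hbc
    have h := hconv a c ((c - b) / (c - a)) (div_nonneg (by linarith) (by linarith))
      ((div_le_one (by linarith)).2 (by linarith))
    have hca : c - a ≠ 0 := by linarith
    have e : (c - b) / (c - a) * a + (1 - (c - b) / (c - a)) * c = b := by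
      field_simp
      ring
    rw [e] at h
    have h' := mul_le_mul_of_nonneg_right h (show 0 ≤ c - a by linarith)
    have e2 : ((c - b) / (c - a) * f a + (1 - (c - b) / (c - a)) * f c) * (c - a)
        = (c - b) * f a + (b - a) * f c := by
      field_simp
      ring
    linarith
  have hd : 0 < y - x := by linarith
  obtain ⟨s, hs⟩ : ∃ s, f y - f x = s * (y - x) := ⟨(f y - f x) / (y - x), by field_simp⟩
  have key : |s| ≤ M := by
    apply hub s (max (s * x - f x) (K + |s - θ0| * max |x| |y|))
    intro z
    by_cases hz : x < z ∧ z < y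
    · have h1 := hK z
      have h2 : (s - θ0) * z ≤ |s - θ0| * max |x| |y| := by
        calc (s - θ0) * z ≤ |(s - θ0) * z| := le_abs_self _
          _ = |s - θ0| * |z| := abs_mul _ _
          _ ≤ _ := by
            refine mul_le_mul_of_nonneg_left (abs_le_max_abs_abs hz.1.le hz.2.le) (abs_nonneg _)
      have := le_max_right (s * x - f x) (K + |s - θ0| * max |x| |y|)
      nlinarith
    · have hm := le_max_left (s * x - f x) (K + |s - θ0| * max |x| |y|)
      suffices s * z - (s * x - f x) ≤ f z by linarith
      rw [not_and_or, not_lt, not_lt] at hz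
      rcases hz with hz | hz
      · rcases hz.eq_or_lt with rfl | hz
        · linarith
        have := h3 z x y hz hxy
        have h5 : f y = f x + s * (y - x) := by linarith
        rw [h5] at this
        have : 0 ≤ (y - x) * (f z - (s * z - (s * x - f x))) := by linarith
        have := nonneg_of_mul_nonneg_right this hd
        linarith
      · rcases hz.eq_or_lt with rfl | hz
        · linarith
        have := h3 x y z hxy hz
        have h5 : f y = f x + s * (y - x) := by linarith
        rw [h5] at this
        have : 0 ≤ (y - x) * (f z - (s * z - (s * x - f x))) := by linarith
        have := nonneg_of_mul_nonneg_right this hd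
        linarith
  rw [abs_sub_comm, hs, abs_mul, abs_sub_comm x y]
  exact mul_le_mul_of_nonneg_right key (abs_nonneg _)

/-- Real-valued data extracted from the hypotheses on `g`. -/
theorem aux_real {g : ℝ → EReal}
    (hgproper : ∃ x, g x ≠ ⊤) (hgbot : ∀ x, g x ≠ ⊥)
    (hgconv : ∀ x y t : ℝ, 0 ≤ t → t ≤ 1 →
      g (t * x + (1 - t) * y) ≤ (t : EReal) * g x + ((1 - t : ℝ) : EReal) * g y)
    {M : ℝ}
    (hMdef : IsLUB {t : ℝ | ∃ θ : ℝ, econj g θ < ⊤ ∧ t = |θ|} M) :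
    ∃ f : ℝ → ℝ, (g = fun x => (f x : EReal)) ∧ (∀ x y, f x ≤ f y + M * |x - y|) ∧
      IsLUB {t : ℝ | ∃ θ K : ℝ, (∀ x, θ * x - K ≤ f x) ∧ t = |θ|} M := by
  have hub : ∀ θ, econj g θ < ⊤ → |θ| ≤ M := fun θ h => hMdef.1 ⟨θ, h, rfl⟩
  obtain ⟨_, θ0, hθ0, -⟩ := hMdef.nonempty
  obtain ⟨K, hK⟩ := aux_minorant hgbot hgproper hθ0
  have hfin := aux_finite hgproper hgbot hgconv hub (hub _ hθ0) hK
  have hg : ∀ x, g x = ((g x).toReal : EReal) := fun x =>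
    (EReal.coe_toReal (hfin x) (hgbot x)).symm
  have hset : {t : ℝ | ∃ θ : ℝ, econj g θ < ⊤ ∧ t = |θ|}
      = {t : ℝ | ∃ θ K : ℝ, (∀ x, θ * x - K ≤ (g x).toReal) ∧ t = |θ|} := by
    ext t
    constructor
    · rintro ⟨θ, h, rfl⟩
      obtain ⟨K, hK⟩ := aux_minorant hgbot hgproper h
      refine ⟨θ, K, fun x => ?_, rfl⟩
      have := hK x
      rw [hg x] at this
      exact_mod_cast this
    · rintro ⟨θ, K, h, rfl⟩
      refine ⟨θ, aux_econj_lt (K := K) hgbot fun x => ?_, rfl⟩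
      rw [hg x]
      exact_mod_cast h x
  have hlip : ∀ x y, x < y → |(g x).toReal - (g y).toReal| ≤ M * |x - y| := by
    refine fun x y hxy => aux_lip (f := fun x => (g x).toReal) (M := M) (θ0 := θ0) (K := K) ?_ ?_ ?_ x y hxy
    · intro x y t h0 h1
      have := hgconv x y t h0 h1
      rw [hg x, hg y, hg (t * x + (1 - t) * y)] at this
      exact_mod_cast this
    · intro θ K h
      rw [hset] at hMdef
      exact hMdef.1 ⟨θ, K, h, rfl⟩
    · intro x
      have := hK x
      rw [hg x] at this
      exact_mod_cast this
  refine ⟨fun x => (g x).toReal, funext hg, ?_, hset ▸ hMdef⟩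
  intro x y
  rcases lt_trichotomy x y with h | rfl | h
  · have := (abs_le.1 (hlip x y h)).2
    linarith
  · simp
  · have := (abs_le.1 (hlip y x h)).1
    rw [abs_sub_comm] at this
    linarith

theorem aux_exp {α : Type} [MeasurableSpace α] (P : Measure α) (h : α → ℝ)
    (hi : Integrable h P) :
    erealExp P (fun z => (h z : EReal)) = ((∫ z, h z ∂P : ℝ) : EReal) := by
  have e1 : ∀ z, erealToENNReal (h z : EReal) = ENNReal.ofReal (h z) := fun z => by
    simp [erealToENNReal]
  have e2 : ∀ z, erealToENNReal (-(h z : EReal)) = ENNReal.ofReal (-(h z)) := fun z => by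
    rw [← EReal.coe_neg, erealToENNReal, if_neg (EReal.coe_ne_top _), EReal.toReal_coe]
  have f1 : ∫⁻ z, ENNReal.ofReal (h z) ∂P ≠ ⊤ := hi.lintegral_lt_top.ne
  have f2 : ∫⁻ z, ENNReal.ofReal (-(h z)) ∂P ≠ ⊤ := hi.neg.lintegral_lt_top.ne
  rw [integral_eq_lintegral_pos_part_sub_lintegral_neg_part hi, EReal.coe_sub]
  simp only [erealExp, e1, e2]
  rw [← EReal.coe_ennreal_toReal f1, ← EReal.coe_ennreal_toReal f2]

theorem aux_knap (n : ℕ) (hn : 0 < n) (c : Fin n → ℝ) (L κ ρ : ℝ) (hκ : 0 < κ) (hρ : 0 < ρ) :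
    ∃ lam : ℝ, L ≤ lam ∧ ∃ p : Fin n → ℝ, (∀ i, 0 ≤ p i ∧ p i ≤ 1) ∧
      (2 * κ) * (1 / (n : ℝ)) * ∑ i, p i ≤ ρ ∧
      ρ * lam + (1 / (n : ℝ)) * ∑ i, max 0 (c i - 2 * κ * lam)
        ≤ (1 / (n : ℝ)) * ∑ i, p i * c i + L * (ρ - (2 * κ) * (1 / (n : ℝ)) * ∑ i, p i) := by
  classical
  have hn' : (0 : ℝ) < 1 / (n : ℝ) := by positivity
  -- strict count and weak count
  let F : ℝ → ℝ := fun lam => (2 * κ) * (1 / (n : ℝ)) * ∑ i, (if 2 * κ * lam < c i then (1 : ℝ) else 0)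
  let G : ℝ → ℝ := fun lam => (2 * κ) * (1 / (n : ℝ)) * ∑ i, (if 2 * κ * lam ≤ c i then (1 : ℝ) else 0)
  have hcont : Continuous fun lam : ℝ => 2 * κ * lam := by fun_prop
  have hFanti : Antitone F := by
    intro x y hxy
    refine mul_le_mul_of_nonneg_left (Finset.sum_le_sum fun i _ => ?_) (by positivity)
    have : 2 * κ * x ≤ 2 * κ * y := by gcongr
    split_ifs <;> first | linarith | norm_num
  -- main value identity
  have val : ∀ lam, L ≤ lam → ∀ p : Fin n → ℝ, (∀ i, p i * (c i - 2 * κ * lam) = max 0 (c i - 2 * κ * lam)) →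
      (lam - L) * (ρ - (2 * κ) * (1 / (n : ℝ)) * ∑ i, p i) = 0 →
      ρ * lam + (1 / (n : ℝ)) * ∑ i, max 0 (c i - 2 * κ * lam)
        ≤ (1 / (n : ℝ)) * ∑ i, p i * c i + L * (ρ - (2 * κ) * (1 / (n : ℝ)) * ∑ i, p i) := by
    intro lam _ p hp h0
    have : ∑ i, max 0 (c i - 2 * κ * lam) = ∑ i, p i * c i - 2 * κ * lam * ∑ i, p i := by
      rw [Finset.mul_sum, ← Finset.sum_sub_distrib]
      refine Finset.sum_congr rfl fun i _ => ?_
      rw [← hp i]; ring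
    rw [this]
    apply le_of_eq
    linear_combination h0
  -- level set
  let S : Set ℝ := {lam | L ≤ lam ∧ F lam ≤ ρ}
  have hSne : S.Nonempty := by
    have h1 : ∀ᶠ lam : ℝ in Filter.atTop, ∀ i, c i / (2 * κ) ≤ lam :=
      Filter.eventually_all.2 fun i => Filter.eventually_ge_atTop _
    obtain ⟨lam, h1, h2⟩ := (h1.and (Filter.eventually_ge_atTop L)).exists
    refine ⟨lam, h2, ?_⟩
    have : F lam = 0 := by
      simp only [F]
      rw [Finset.sum_eq_zero, mul_zero]
      intro i _
      have := (div_le_iff₀ (by positivity)).1 (h1 i)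
      rw [if_neg (by linarith)]
    rw [this]; exact hρ.le
  have hSbd : BddBelow S := ⟨L, fun x hx => hx.1⟩
  set lam := sInf S with hlam
  have hLlam : L ≤ lam := le_csInf hSne fun x hx => hx.1
  have hFlam : F lam ≤ ρ := by
    have h1 : ∀ᶠ x in nhdsWithin lam (Set.Ioi lam), ∀ i, 2 * κ * lam < c i → 2 * κ * x < c i := by
      refine Filter.eventually_all.2 fun i => ?_
      by_cases h : 2 * κ * lam < c i
      · have := (hcont.tendsto lam).eventually (gt_mem_nhds h)
        filter_upwards [nhdsWithin_le_nhds this] with x hx _ using hx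
      · exact Filter.Eventually.of_forall fun x h' => absurd h' h
    obtain ⟨x, h1, h2⟩ := (h1.and self_mem_nhdsWithin).exists
    obtain ⟨y, hy, hyx⟩ := exists_lt_of_csInf_lt hSne (show sInf S < x from h2)
    refine le_trans ?_ ((hFanti hyx.le).trans hy.2)
    refine mul_le_mul_of_nonneg_left (Finset.sum_le_sum fun i _ => ?_) (by positivity)
    by_cases h : 2 * κ * lam < c i
    · rw [if_pos h, if_pos (h1 i h)]
    · rw [if_neg h]; split_ifs <;> norm_num
  refine ⟨lam, hLlam, ?_⟩
  rcases hLlam.eq_or_lt with heq | hlt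
  · refine ⟨fun i => if 2 * κ * lam < c i then (1 : ℝ) else 0, fun i => ?_, hFlam, val lam hLlam _ ?_ ?_⟩
    · dsimp only; split_ifs <;> norm_num
    · intro i
      split_ifs with h
      · rw [max_eq_right (by linarith)]; ring
      · rw [max_eq_left (by linarith)]; ring
    · rw [← heq]; ring
  · have hGlam : ρ ≤ G lam := by
      have h1 : ∀ᶠ x in nhdsWithin lam (Set.Iio lam), ∀ i, c i < 2 * κ * lam → c i < 2 * κ * x := by
        refine Filter.eventually_all.2 fun i => ?_
        by_cases h : c i < 2 * κ * lam
        · have := (hcont.tendsto lam).eventually (lt_mem_nhds h)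
          filter_upwards [nhdsWithin_le_nhds this] with x hx _ using hx
        · exact Filter.Eventually.of_forall fun x h' => absurd h' h
      have h3 : ∀ᶠ x in nhdsWithin lam (Set.Iio lam), L < x := nhdsWithin_le_nhds (lt_mem_nhds hlt)
      obtain ⟨x, ⟨h1, h3⟩, h2⟩ := ((h1.and h3).and self_mem_nhdsWithin).exists
      have hx : ρ < F x := by
        by_contra hc
        have : lam ≤ x := csInf_le hSbd ⟨h3.le, not_lt.1 hc⟩
        exact absurd h2 (not_lt.2 this)
      refine hx.le.trans ?_
      refine mul_le_mul_of_nonneg_left (Finset.sum_le_sum fun i _ => ?_) (by positivity)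
      by_cases h : 2 * κ * lam ≤ c i
      · rw [if_pos h]; split_ifs <;> norm_num
      · rw [if_neg h, if_neg (not_lt.2 (h1 i (not_le.1 h)).le)]
    obtain ⟨τ, h0, h1, hτ⟩ : ∃ τ : ℝ, 0 ≤ τ ∧ τ ≤ 1 ∧ (1 - τ) * F lam + τ * G lam = ρ := by
      rcases hGlam.eq_or_lt with h | h
      · exact ⟨1, by norm_num, le_rfl, by rw [h]; ring⟩
      · have hd : 0 < G lam - F lam := by linarith
        refine ⟨(ρ - F lam) / (G lam - F lam), div_nonneg (by linarith) hd.le,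
          (div_le_one hd).2 (by linarith), ?_⟩
        field_simp
        ring
    let p : Fin n → ℝ := fun i => (1 - τ) * (if 2 * κ * lam < c i then (1 : ℝ) else 0)
      + τ * (if 2 * κ * lam ≤ c i then (1 : ℝ) else 0)
    have hp : (2 * κ) * (1 / (n : ℝ)) * ∑ i, p i = ρ := by
      rw [← hτ]
      simp only [p, F, G, Finset.sum_add_distrib, ← Finset.mul_sum]
      ring
    refine ⟨p, fun i => ?_, hp.le, val lam hLlam p ?_ ?_⟩
    · simp only [p]
      split_ifs <;> constructor <;> linarith
    · intro i
      simp only [p]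
      rcases lt_trichotomy (2 * κ * lam) (c i) with h | h | h
      · rw [if_pos h, if_pos h.le, max_eq_right (by linarith)]; ring
      · rw [← h]; simp
      · rw [if_neg (by linarith), if_neg (by linarith), max_eq_left (by linarith)]; ring
    · rw [hp]; ring

theorem aux_disc {α J : Type} [MeasurableSpace α] [MeasurableSingletonClass α] [Fintype J]
    (q : J → ℝ) (hq : ∀ j, 0 ≤ q j) (z : J → α) (h : α → ℝ) :
    Integrable h (∑ j, ENNReal.ofReal (q j) • Measure.dirac (z j)) ∧
    ∫ x, h x ∂(∑ j, ENNReal.ofReal (q j) • Measure.dirac (z j)) = ∑ j, q j * h (z j) := by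
  have hi : ∀ j ∈ Finset.univ, Integrable h (ENNReal.ofReal (q j) • Measure.dirac (z j)) :=
    fun j _ => (integrable_dirac (by simp [enorm_lt_top])).smul_measure ENNReal.ofReal_ne_top
  refine ⟨integrable_finsetSum_measure.2 hi, ?_⟩
  rw [integral_finsetSum_measure hi]
  refine Finset.sum_congr rfl fun j _ => ?_
  rw [integral_smul_measure, integral_dirac, ENNReal.toReal_ofReal (hq j), smul_eq_mul]

theorem aux_map_disc {α β J : Type} [MeasurableSpace α] [MeasurableSpace β] [Fintype J]
    (q : J → ℝ≥0∞) (z : J → α) (F : α → β) (hF : Measurable F) :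
    (∑ j, q j • Measure.dirac (z j)).map F = ∑ j, q j • Measure.dirac (F (z j)) := by
  ext s hs
  rw [Measure.map_apply hF hs]
  simp only [Measure.coe_finsetSum, Finset.sum_apply, Measure.smul_apply]
  refine Finset.sum_congr rfl fun j _ => ?_
  rw [Measure.dirac_apply' _ (hF hs), Measure.dirac_apply' _ hs]
  rfl

theorem aux_Q {α : Type} [MeasurableSpace α] (n : ℕ) (hn : 0 < n) (z : Fin n → α) :
    ((n : ℝ≥0∞))⁻¹ • ∑ i : Fin n, Measure.dirac (z i)
      = ∑ i, ENNReal.ofReal (1 / (n : ℝ)) • Measure.dirac (z i) := by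
  rw [Finset.smul_sum, one_div, ENNReal.ofReal_inv_of_pos (by positivity), ENNReal.ofReal_natCast]

section
variable {d : ℕ} {N Nstar : EuclideanSpace ℝ (Fin d) → ℝ}

theorem aux_Nnonneg
    (hN0 : ∀ x, N x = 0 ↔ x = 0)
    (hNsmul : ∀ (c : ℝ) x, N (c • x) = |c| * N x)
    (hNadd : ∀ x y, N (x + y) ≤ N x + N y) (x) : 0 ≤ N x := by
  have h1 := hNadd x ((-1 : ℝ) • x)
  have h2 := hNsmul (-1) x
  have h3 : x + (-1 : ℝ) • x = 0 := by simp
  rw [h3, (hN0 0).2 rfl, h2] at h1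
  norm_num at h1
  linarith

theorem aux_dual
    (hN0 : ∀ x, N x = 0 ↔ x = 0)
    (hNsmul : ∀ (c : ℝ) x, N (c • x) = |c| * N x)
    (hNadd : ∀ x y, N (x + y) ≤ N x + N y)
    (hNstar : ∀ w, IsLUB {t : ℝ | ∃ x, N x ≤ 1 ∧ t = ⟪x, w⟫} (Nstar w)) (x w) :
    |⟪x, w⟫| ≤ Nstar w * N x := by
  have hnn := aux_Nnonneg hN0 hNsmul hNadd
  have key : ∀ x, ⟪x, w⟫ ≤ Nstar w * N x := by
    intro x
    by_cases hx : N x = 0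
    · rw [hx, (hN0 x).1 hx]; simp
    · have hpos : 0 < N x := lt_of_le_of_ne (hnn x) (Ne.symm hx)
      have := (hNstar w).1 ⟨(N x)⁻¹ • x, by
        rw [hNsmul, abs_of_pos (inv_pos.2 hpos), inv_mul_cancel₀ hx], rfl⟩
      rw [real_inner_smul_left, inv_mul_le_iff₀ hpos] at this
      linarith
  rw [abs_le]
  have h1 := key ((-1 : ℝ) • x)
  rw [hNsmul, real_inner_smul_left] at h1
  norm_num at h1
  exact ⟨by linarith, key x⟩

theorem aux_weak_pi (nn : ℕ) (hn : 0 < nn)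
    (a : Fin nn → EuclideanSpace ℝ (Fin d)) (bb : Fin nn → ℝ)
    (hbb : ∀ i, bb i = 1 ∨ bb i = -1)
    (f : ℝ → ℝ) (M : ℝ) (hM : 0 < M) (hlip : ∀ x y, f x ≤ f y + M * |x - y|)
    (hN0 : ∀ x, N x = 0 ↔ x = 0)
    (hNsmul : ∀ (c : ℝ) x, N (c • x) = |c| * N x)
    (hNadd : ∀ x y, N (x + y) ≤ N x + N y)
    (hNcont : Continuous N)
    (hNstar : ∀ w, IsLUB {t : ℝ | ∃ x, N x ≤ 1 ∧ t = ⟪x, w⟫} (Nstar w))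
    (κ : ℝ) (hκ : 0 < κ)
    (w : EuclideanSpace ℝ (Fin d)) (lam : ℝ) (hlam : Nstar w ≤ lam / M) (s : Fin nn → ℝ)
    (hs1 : ∀ i, f (bb i * ⟪a i, w⟫) ≤ s i)
    (hs2 : ∀ i, f (-(bb i * ⟪a i, w⟫)) ≤ 2 * κ * lam + s i)
    (P : Measure (EuclideanSpace ℝ (Fin d) × ℝ)) [IsProbabilityMeasure P]
    (hP : P {z : EuclideanSpace ℝ (Fin d) × ℝ | z.2 = 1 ∨ z.2 = -1} = 1)
    (π : Measure ((EuclideanSpace ℝ (Fin d) × ℝ) × (EuclideanSpace ℝ (Fin d) × ℝ)))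
    (h1 : π.map Prod.fst = P)
    (h2 : π.map Prod.snd = ∑ i, ENNReal.ofReal (1 / (nn : ℝ)) • Measure.dirac (a i, bb i))
    (C : ℝ) (hC0 : 0 ≤ C)
    (hC : ∫⁻ pq, ENNReal.ofReal (N (pq.1.1 - pq.2.1) + κ * |pq.1.2 - pq.2.2|) ∂π
      ≤ ENNReal.ofReal C) :
    Integrable (fun z : EuclideanSpace ℝ (Fin d) × ℝ => f (z.2 * ⟪z.1, w⟫)) P ∧
    ∫ z, f (z.2 * ⟪z.1, w⟫) ∂P ≤ C * lam + (1 / (nn : ℝ)) * ∑ i, s i := by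
  have hnn := aux_Nnonneg hN0 hNsmul hNadd
  have hdual := aux_dual hN0 hNsmul hNadd hNstar
  have hlam' : M * Nstar w ≤ lam := by
    rw [le_div_iff₀ hM] at hlam; linarith
  have hlam0 : 0 ≤ lam := by
    have := (hNstar w).1 ⟨0, by rw [(hN0 0).2 rfl]; norm_num, rfl⟩
    simp at this
    have := mul_nonneg hM.le this
    linarith
  have hfl : LipschitzWith ⟨M, hM.le⟩ f := by
    refine LipschitzWith.of_le_add_mul _ fun x y => ?_
    rw [Real.dist_eq]
    exact hlip x y
  have hfc : Continuous f := hfl.continuous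
  let cost : ((EuclideanSpace ℝ (Fin d) × ℝ) × (EuclideanSpace ℝ (Fin d) × ℝ)) → ℝ :=
    fun pq => N (pq.1.1 - pq.2.1) + κ * |pq.1.2 - pq.2.2|
  have hcostc : Continuous cost := by
    simp only [cost]; fun_prop
  have hcost0 : ∀ pq, 0 ≤ cost pq := fun pq =>
    add_nonneg (hnn _) (mul_nonneg hκ.le (abs_nonneg _))
  have hcostI : Integrable cost π := by
    refine ⟨hcostc.aestronglyMeasurable, ?_⟩
    rw [hasFiniteIntegral_iff_ofReal (Filter.Eventually.of_forall hcost0)]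
    exact lt_of_le_of_lt hC ENNReal.ofReal_lt_top
  have hcostC : ∫ pq, cost pq ∂π ≤ C := by
    rw [integral_eq_lintegral_of_nonneg_ae (Filter.Eventually.of_forall hcost0)
      hcostc.aestronglyMeasurable]
    exact ENNReal.toReal_le_of_le_ofReal hC0 hC
  have hlab : MeasurableSet {z : EuclideanSpace ℝ (Fin d) × ℝ | z.2 = 1 ∨ z.2 = -1} :=
    (measurableSet_eq_fun measurable_snd measurable_const).union
      (measurableSet_eq_fun measurable_snd measurable_const)
  have aeP : ∀ᵐ pq ∂π, pq.1.2 = 1 ∨ pq.1.2 = -1 := by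
    have : ∀ᵐ z ∂P, z.2 = 1 ∨ z.2 = -1 := (mem_ae_iff_prob_eq_one hlab).2 hP
    rw [← h1] at this
    exact ae_of_ae_map measurable_fst.aemeasurable this
  have aeQ : ∀ᵐ pq ∂π, pq.2.2 = 1 ∨ pq.2.2 = -1 := by
    have : ∀ᵐ z ∂(π.map Prod.snd), z.2 = 1 ∨ z.2 = -1 := by
      rw [h2, ae_iff]
      simp only [Measure.coe_finsetSum, Finset.sum_apply, Measure.smul_apply]
      refine Finset.sum_eq_zero fun i _ => ?_
      rw [Measure.dirac_apply, Set.indicator_of_notMem, smul_zero]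
      exact not_not.2 (hbb i)
    exact ae_of_ae_map measurable_snd.aemeasurable this
  have hshift : ∀ (y : ℝ) (x x' : EuclideanSpace ℝ (Fin d)), (y = 1 ∨ y = -1) →
      |f (y * ⟪x, w⟫) - f (y * ⟪x', w⟫)| ≤ lam * N (x - x') := by
    intro y x x' hy
    have e : |y * ⟪x, w⟫ - y * ⟪x', w⟫| ≤ Nstar w * N (x - x') := by
      rw [← mul_sub, ← inner_sub_left, abs_mul]
      have : |y| = 1 := by rcases hy with rfl | rfl <;> simp
      rw [this, one_mul]
      exact hdual _ _
    have e2 : M * |y * ⟪x, w⟫ - y * ⟪x', w⟫| ≤ lam * N (x - x') := by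
      calc _ ≤ M * (Nstar w * N (x - x')) := mul_le_mul_of_nonneg_left e hM.le
        _ = (M * Nstar w) * N (x - x') := by ring
        _ ≤ _ := mul_le_mul_of_nonneg_right hlam' (hnn _)
    have l1 := hlip (y * ⟪x, w⟫) (y * ⟪x', w⟫)
    have l2 := hlip (y * ⟪x', w⟫) (y * ⟪x, w⟫)
    rw [abs_sub_comm (y * ⟪x', w⟫)] at l2
    rw [abs_le]
    constructor <;> linarith
  let φ : EuclideanSpace ℝ (Fin d) × ℝ → ℝ := fun z =>
    max (f (z.2 * ⟪z.1, w⟫)) (f (-(z.2 * ⟪z.1, w⟫)) - 2 * κ * lam)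
  let ψ : EuclideanSpace ℝ (Fin d) × ℝ → ℝ := fun z => |f ⟪z.1, w⟫| + |f (-⟪z.1, w⟫)|
  have hφc : Continuous φ := by simp only [φ]; fun_prop
  have hψc : Continuous ψ := by simp only [ψ]; fun_prop
  have hq : ∀ i : Fin nn, (0 : ℝ) ≤ 1 / (nn : ℝ) := fun _ => by positivity
  have hφQ := aux_disc (fun _ : Fin nn => 1 / (nn : ℝ)) hq (fun i => (a i, bb i)) φ
  have hψQ := aux_disc (fun _ : Fin nn => 1 / (nn : ℝ)) hq (fun i => (a i, bb i)) ψ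
  rw [← h2] at hφQ hψQ
  have hφI : Integrable (fun pq => φ pq.2) π := hφQ.1.comp_measurable measurable_snd
  have hψI : Integrable (fun pq => ψ pq.2) π := hψQ.1.comp_measurable measurable_snd
  have hφint : ∫ pq, φ pq.2 ∂π ≤ (1 / (nn : ℝ)) * ∑ i, s i := by
    rw [← integral_map measurable_snd.aemeasurable hφc.aestronglyMeasurable, hφQ.2, ← Finset.mul_sum]
    refine mul_le_mul_of_nonneg_left (Finset.sum_le_sum fun i _ => ?_) (by positivity)
    have := hs1 i
    have := hs2 i
    exact max_le (by assumption) (by dsimp only; linarith)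
  let h : EuclideanSpace ℝ (Fin d) × ℝ → ℝ := fun z => f (z.2 * ⟪z.1, w⟫)
  have hhc : Continuous h := by simp only [h]; fun_prop
  have hub : ∀ᵐ pq ∂π, h pq.1 ≤ φ pq.2 + lam * cost pq := by
    filter_upwards [aeP, aeQ] with ⟨⟨x, y⟩, ⟨x', y'⟩⟩ hy hy'
    simp only at hy hy'
    have hsh := (abs_le.1 (hshift y x x' hy)).2
    have m1 := le_max_left (f (y' * ⟪x', w⟫)) (f (-(y' * ⟪x', w⟫)) - 2 * κ * lam)
    have m2 := le_max_right (f (y' * ⟪x', w⟫)) (f (-(y' * ⟪x', w⟫)) - 2 * κ * lam)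
    simp only [h, φ, cost]
    by_cases hyy : y = y'
    · subst hyy
      simp only [sub_self, abs_zero, mul_zero, add_zero]
      linarith
    · have hyn : y = -y' := by
        rcases hy with rfl | rfl <;> rcases hy' with rfl | rfl <;> simp_all
      have habs : |y - y'| = 2 := by
        rcases hy' with rfl | rfl <;> rw [hyn] <;> norm_num
      rw [habs]
      have e : y * ⟪x', w⟫ = -(y' * ⟪x', w⟫) := by rw [hyn]; ring
      rw [e] at hsh
      linarith
  have hbd : ∀ᵐ pq ∂π, ‖h pq.1‖ ≤ ψ pq.2 + lam * cost pq := by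
    filter_upwards [aeP] with ⟨⟨x, y⟩, ⟨x', y'⟩⟩ hy
    simp only at hy
    have hsh := hshift y x x' hy
    have hc : lam * N (x - x') ≤ lam * (N (x - x') + κ * |y - y'|) := by
      refine mul_le_mul_of_nonneg_left ?_ hlam0
      have := mul_nonneg hκ.le (abs_nonneg (y - y'))
      linarith
    have ht := abs_sub_abs_le_abs_sub (f (y * ⟪x, w⟫)) (f (y * ⟪x', w⟫))
    have hb : |f (y * ⟪x', w⟫)| ≤ |f ⟪x', w⟫| + |f (-⟪x', w⟫)| := by
      have p1 := abs_nonneg (f ⟪x', w⟫)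
      have p2 := abs_nonneg (f (-⟪x', w⟫))
      rcases hy with rfl | rfl
      · rw [one_mul]; linarith
      · rw [neg_one_mul]; linarith
    simp only [h, ψ, cost, Real.norm_eq_abs]
    linarith
  have hhI : Integrable (fun pq => h pq.1) π :=
    (hψI.add (hcostI.const_mul lam)).mono' (hhc.comp continuous_fst).aestronglyMeasurable hbd
  constructor
  · rw [← h1]
    exact (integrable_map_measure hhc.aestronglyMeasurable measurable_fst.aemeasurable).2 hhI
  · rw [← h1]
    change ∫ z, h z ∂_ ≤ _
    rw [integral_map measurable_fst.aemeasurable hhc.aestronglyMeasurable]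
    refine (integral_mono_ae hhI (hφI.add (hcostI.const_mul lam)) hub).trans ?_
    have e : ∫ pq, (φ pq.2 + lam * cost pq) ∂π
        = ∫ pq, φ pq.2 ∂π + lam * ∫ pq, cost pq ∂π := by
      rw [← integral_const_mul]
      exact integral_add hφI (hcostI.const_mul lam)
    refine e.le.trans ?_
    have := mul_le_mul_of_nonneg_left hcostC hlam0
    linarith

theorem aux_P {J : Type} [Fintype J] (κ ρ : ℝ) (hκ : 0 < κ)
    (hnn : ∀ x, 0 ≤ N x)
    (q : J → ℝ) (hq : ∀ j, 0 ≤ q j) (hq1 : ∑ j, q j = 1)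
    (z y : J → EuclideanSpace ℝ (Fin d) × ℝ) (hz : ∀ j, (z j).2 = 1 ∨ (z j).2 = -1)
    (Q : Measure (EuclideanSpace ℝ (Fin d) × ℝ))
    (hQ : Q = ∑ j, ENNReal.ofReal (q j) • Measure.dirac (y j))
    (hc : ∑ j, q j * (N ((z j).1 - (y j).1) + κ * |(z j).2 - (y j).2|) ≤ ρ)
    (P : Measure (EuclideanSpace ℝ (Fin d) × ℝ))
    (hPdef : P = ∑ j, ENNReal.ofReal (q j) • Measure.dirac (z j)) :
    IsProbabilityMeasure P ∧
      P {z : EuclideanSpace ℝ (Fin d) × ℝ | z.2 = 1 ∨ z.2 = -1} = 1 ∧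
      sInf {W : ℝ≥0∞ |
          ∃ π : Measure ((EuclideanSpace ℝ (Fin d) × ℝ) × (EuclideanSpace ℝ (Fin d) × ℝ)),
            IsProbabilityMeasure π ∧
            π.map Prod.fst = P ∧ π.map Prod.snd = Q ∧
            W = ∫⁻ pq, ENNReal.ofReal (N (pq.1.1 - pq.2.1) + κ * |pq.1.2 - pq.2.2|) ∂π}
        ≤ ENNReal.ofReal ρ := by
  have hsum : ∑ j, ENNReal.ofReal (q j) = 1 := by
    rw [← ENNReal.ofReal_sum_of_nonneg fun j _ => hq j, hq1, ENNReal.ofReal_one]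
  refine ⟨⟨?_⟩, ?_, ?_⟩
  · rw [hPdef]
    simp [hsum]
  · rw [hPdef]
    simp only [Measure.coe_finsetSum, Finset.sum_apply, Measure.smul_apply]
    rw [← hsum]
    refine Finset.sum_congr rfl fun j _ => ?_
    rw [Measure.dirac_apply, Set.indicator_of_mem (by exact hz j)]
    simp
  · refine sInf_le_of_le
      ⟨∑ j, ENNReal.ofReal (q j) • Measure.dirac (z j, y j), ⟨by simp [hsum]⟩, ?_, ?_, rfl⟩ ?_
    · rw [aux_map_disc _ _ _ measurable_fst, hPdef]
    · rw [aux_map_disc _ _ _ measurable_snd, hQ]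
    · rw [lintegral_finsetSum_measure]
      refine le_trans (le_of_eq ?_) (ENNReal.ofReal_le_ofReal hc)
      rw [ENNReal.ofReal_sum_of_nonneg fun j _ => mul_nonneg (hq j)
        (add_nonneg (hnn _) (mul_nonneg hκ.le (abs_nonneg _)))]
      refine Finset.sum_congr rfl fun j _ => ?_
      rw [lintegral_smul_measure, lintegral_dirac, ENNReal.ofReal_mul (hq j)]
      rfl

end

theorem aux_lub {S : Set ℝ} {m c B : ℝ} (h : IsLUB S m) (hc : 0 ≤ c)
    (hB : ∀ t ∈ S, c * t ≤ B) : c * m ≤ B := by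
  rcases hc.eq_or_lt with rfl | hc
  · obtain ⟨t, ht⟩ := h.nonempty
    have := hB t ht
    simpa using this
  · rw [mul_comm, ← le_div_iff₀ hc]
    refine h.2 fun t ht => ?_
    rw [le_div_iff₀ hc, mul_comm]
    exact hB t ht

theorem aux_strong {d : ℕ} {N Nstar : EuclideanSpace ℝ (Fin d) → ℝ} (nn : ℕ) (hn : 0 < nn)
    (a : Fin nn → EuclideanSpace ℝ (Fin d)) (bb : Fin nn → ℝ)
    (hbb : ∀ i, bb i = 1 ∨ bb i = -1)
    (f : ℝ → ℝ) (M : ℝ)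
    (hMdef : IsLUB {t : ℝ | ∃ θ K : ℝ, (∀ x, θ * x - K ≤ f x) ∧ t = |θ|} M)
    (hN0 : ∀ x, N x = 0 ↔ x = 0)
    (hNsmul : ∀ (c : ℝ) x, N (c • x) = |c| * N x)
    (hNadd : ∀ x y, N (x + y) ≤ N x + N y)
    (hNstar : ∀ w, IsLUB {t : ℝ | ∃ x, N x ≤ 1 ∧ t = ⟪x, w⟫} (Nstar w))
    (κ ρ : ℝ) (hκ : 0 < κ)
    (Q : Measure (EuclideanSpace ℝ (Fin d) × ℝ))
    (hQ : Q = ∑ i, ENNReal.ofReal (1 / (nn : ℝ)) • Measure.dirac (a i, bb i))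
    (w : EuclideanSpace ℝ (Fin d)) (r : ℝ)
    (hr : ∀ P : Measure (EuclideanSpace ℝ (Fin d) × ℝ), IsProbabilityMeasure P ∧
      P {z : EuclideanSpace ℝ (Fin d) × ℝ | z.2 = 1 ∨ z.2 = -1} = 1 ∧
      sInf {W : ℝ≥0∞ |
          ∃ π : Measure ((EuclideanSpace ℝ (Fin d) × ℝ) × (EuclideanSpace ℝ (Fin d) × ℝ)),
            IsProbabilityMeasure π ∧
            π.map Prod.fst = P ∧ π.map Prod.snd = Q ∧
            W = ∫⁻ pq, ENNReal.ofReal (N (pq.1.1 - pq.2.1) + κ * |pq.1.2 - pq.2.2|) ∂π}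
        ≤ ENNReal.ofReal ρ →
      erealExp P (fun z => ((f (z.2 * ⟪z.1, w⟫) : ℝ) : EReal)) ≤ (r : EReal))
    (p : Fin nn → ℝ) (hp : ∀ i, 0 ≤ p i ∧ p i ≤ 1)
    (hpρ : (2 * κ) * (1 / (nn : ℝ)) * ∑ i, p i ≤ ρ) :
    (1 / (nn : ℝ)) * ∑ i, (f (bb i * ⟪a i, w⟫)
        + p i * (f (-(bb i * ⟪a i, w⟫)) - f (bb i * ⟪a i, w⟫)))
      + M * Nstar w * (ρ - (2 * κ) * (1 / (nn : ℝ)) * ∑ i, p i) ≤ r := by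
  have hnn := aux_Nnonneg hN0 hNsmul hNadd
  have hn' : (0 : ℝ) < 1 / (nn : ℝ) := by positivity
  have hnsum : ∑ _i : Fin nn, (1 / (nn : ℝ)) = 1 := by
    simp; field_simp
  set ρ' := ρ - (2 * κ) * (1 / (nn : ℝ)) * ∑ i, p i with hρ'
  have hρ'0 : 0 ≤ ρ' := by linarith
  set E0 := (1 / (nn : ℝ)) * ∑ i, (f (bb i * ⟪a i, w⟫)
        + p i * (f (-(bb i * ⟪a i, w⟫)) - f (bb i * ⟪a i, w⟫))) with hE0
  have step1 : ∀ θ K : ℝ, (∀ x, θ * x - K ≤ f x) → ∀ x, N x ≤ 1 → ∀ δ : ℝ, 0 < δ → δ < 1 →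
      (1 - δ) * E0 + δ * ((1 / (nn : ℝ)) * ∑ i, (θ * (bb i * ⟪a i, w⟫) - K))
        + |θ| * ρ' * ⟪x, w⟫ ≤ r := by
    intro θ K hK x hx δ hδ0 hδ1
    obtain ⟨σ, hσ1, hσ⟩ : ∃ σ : ℝ, |σ| = 1 ∧ θ * σ = |θ| := by
      rcases le_total 0 θ with h | h
      · exact ⟨1, by simp, by rw [abs_of_nonneg h]; ring⟩
      · exact ⟨-1, by simp, by rw [abs_of_nonpos h]; ring⟩
    let R := ρ' / δ
    have hR0 : 0 ≤ R := div_nonneg hρ'0 hδ0.le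
    have hRδ : δ * R = ρ' := by simp only [R]; field_simp
    let q : Fin nn × Fin 3 → ℝ := fun j =>
      (1 / (nn : ℝ)) * (![(1 - δ) * (1 - p j.1), (1 - δ) * p j.1, δ] j.2)
    let y : Fin nn × Fin 3 → EuclideanSpace ℝ (Fin d) × ℝ := fun j => (a j.1, bb j.1)
    let z : Fin nn × Fin 3 → EuclideanSpace ℝ (Fin d) × ℝ := fun j =>
      (![(a j.1, bb j.1), (a j.1, -bb j.1), (a j.1 + (bb j.1 * σ * R) • x, bb j.1)] :
        Fin 3 → EuclideanSpace ℝ (Fin d) × ℝ) j.2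
    have hbabs : ∀ i, |bb i| = 1 := fun i => by rcases hbb i with h | h <;> rw [h] <;> simp
    have hbsq : ∀ i, bb i * bb i = 1 := fun i => by rcases hbb i with h | h <;> rw [h] <;> norm_num
    have hq : ∀ j, 0 ≤ q j := by
      rintro ⟨i, k⟩
      have := hp i
      refine mul_nonneg hn'.le ?_
      fin_cases k
      · exact mul_nonneg (by linarith) (by linarith)
      · exact mul_nonneg (by linarith) (by linarith)
      · exact hδ0.le
    have hz : ∀ j, (z j).2 = 1 ∨ (z j).2 = -1 := by
      rintro ⟨i, k⟩
      fin_cases k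
      · exact hbb i
      · change -bb i = 1 ∨ -bb i = -1
        rcases hbb i with h | h <;> rw [h] <;> simp
      · exact hbb i
    have hq1 : ∑ j, q j = 1 := by
      rw [Fintype.sum_prod_type, ← hnsum]
      refine Finset.sum_congr rfl fun i _ => ?_
      simp [q, Fin.sum_univ_three]
      ring
    have hQ' : Q = ∑ j, ENNReal.ofReal (q j) • Measure.dirac (y j) := by
      rw [hQ, Fintype.sum_prod_type]
      refine Finset.sum_congr rfl fun i _ => ?_
      simp only [y]
      rw [← Finset.sum_smul, ← ENNReal.ofReal_sum_of_nonneg fun k _ => hq (i, k)]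
      congr 2
      simp [q, Fin.sum_univ_three]
      ring
    have hcost : ∑ j, q j * (N ((z j).1 - (y j).1) + κ * |(z j).2 - (y j).2|) ≤ ρ := by
      have hi : ∀ i, ∑ k, q (i, k) * (N ((z (i, k)).1 - (y (i, k)).1)
          + κ * |(z (i, k)).2 - (y (i, k)).2|)
          ≤ (1 - δ) * (2 * κ * (1 / (nn : ℝ)) * p i) + (1 / (nn : ℝ)) * ρ' := by
        intro i
        have e1 : |-bb i - bb i| = 2 := by
          rcases hbb i with h | h <;> rw [h] <;> norm_num
        have e2 : N ((bb i * σ * R) • x) ≤ R := by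
          rw [hNsmul, abs_mul, abs_mul, hbabs, hσ1, abs_of_nonneg hR0]
          nlinarith
        have e3 := mul_le_mul_of_nonneg_left e2 (mul_nonneg hn'.le hδ0.le)
        have e4 : N (0 : EuclideanSpace ℝ (Fin d)) = 0 := (hN0 0).2 rfl
        simp only [Fin.sum_univ_three, q, z, y, Matrix.cons_val_zero, Matrix.cons_val_one,
          Matrix.cons_val, sub_self, abs_zero, mul_zero, add_zero, e4, e1, add_sub_cancel_left]
        rw [mul_assoc _ δ R, hRδ] at e3
        linarith
      rw [Fintype.sum_prod_type]
      refine (Finset.sum_le_sum fun i _ => hi i).trans ?_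
      rw [Finset.sum_add_distrib, ← Finset.mul_sum, ← Finset.mul_sum, ← Finset.sum_mul, hnsum]
      have : 0 ≤ 2 * κ * (1 / (nn : ℝ)) * ∑ i, p i :=
        mul_nonneg (by positivity) (Finset.sum_nonneg fun i _ => (hp i).1)
      nlinarith
    have hfeas := aux_P κ ρ hκ hnn q hq hq1 z y hz Q hQ' hcost _ rfl
    have hE := hr _ hfeas
    have hd := aux_disc q hq z (fun z => f (z.2 * ⟪z.1, w⟫))
    rw [aux_exp _ _ hd.1, EReal.coe_le_coe_iff, hd.2, Fintype.sum_prod_type] at hE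
    refine le_trans ?_ hE
    have hi : ∀ i, (1 - δ) * ((1 / (nn : ℝ)) * (f (bb i * ⟪a i, w⟫)
        + p i * (f (-(bb i * ⟪a i, w⟫)) - f (bb i * ⟪a i, w⟫))))
        + δ * ((1 / (nn : ℝ)) * (θ * (bb i * ⟪a i, w⟫) - K))
        + (1 / (nn : ℝ)) * (|θ| * ρ' * ⟪x, w⟫)
        ≤ ∑ k, q (i, k) * f ((z (i, k)).2 * ⟪(z (i, k)).1, w⟫) := by
      intro i
      have e1 : bb i * ⟪a i + (bb i * σ * R) • x, w⟫ = bb i * ⟪a i, w⟫ + σ * R * ⟪x, w⟫ := by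
        rw [inner_add_left, real_inner_smul_left]
        linear_combination (σ * R * ⟪x, w⟫) * hbsq i
      have e2 := hK (bb i * ⟪a i, w⟫ + σ * R * ⟪x, w⟫)
      have e3 := mul_le_mul_of_nonneg_left e2 (mul_nonneg hn'.le hδ0.le)
      have e4 : 1 / (nn : ℝ) * δ * (θ * (bb i * ⟪a i, w⟫ + σ * R * ⟪x, w⟫) - K)
        = δ * ((1 / (nn : ℝ)) * (θ * (bb i * ⟪a i, w⟫) - K))
        + (1 / (nn : ℝ)) * (|θ| * ρ' * ⟪x, w⟫) := by
        rw [← hσ, ← hRδ]; ring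
      rw [e4] at e3
      simp only [Fin.sum_univ_three, q, z, Matrix.cons_val_zero, Matrix.cons_val_one,
          Matrix.cons_val, e1, neg_mul]
      linarith
    refine le_trans (le_of_eq ?_) (Finset.sum_le_sum fun i _ => hi i)
    rw [Finset.sum_add_distrib, Finset.sum_add_distrib, ← Finset.mul_sum, ← Finset.mul_sum,
      ← Finset.mul_sum, ← Finset.mul_sum, ← Finset.sum_mul, hnsum, one_mul]
  have step2 : ∀ θ K : ℝ, (∀ x, θ * x - K ≤ f x) → ∀ x, N x ≤ 1 →
      E0 + |θ| * ρ' * ⟪x, w⟫ ≤ r := by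
    intro θ K hK x hx
    set A := (1 / (nn : ℝ)) * ∑ i, (θ * (bb i * ⟪a i, w⟫) - K)
    have hc : Continuous fun δ : ℝ => (1 - δ) * E0 + δ * A + |θ| * ρ' * ⟪x, w⟫ := by fun_prop
    have ht := (hc.tendsto 0).mono_left (nhdsWithin_le_nhds (s := Set.Ioi 0))
    have hev : ∀ᶠ δ : ℝ in nhdsWithin 0 (Set.Ioi 0),
        (1 - δ) * E0 + δ * A + |θ| * ρ' * ⟪x, w⟫ ≤ r := by
      filter_upwards [Ioo_mem_nhdsGT (show (0 : ℝ) < 1 by norm_num)] with δ hδ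
      exact step1 θ K hK x hx δ hδ.1 hδ.2
    have := le_of_tendsto ht hev
    simpa using this
  have step3 : ∀ θ K : ℝ, (∀ x, θ * x - K ≤ f x) → |θ| * ρ' * Nstar w ≤ r - E0 := by
    intro θ K hK
    refine aux_lub (hNstar w) (mul_nonneg (abs_nonneg _) hρ'0) ?_
    rintro _ ⟨x, hx, rfl⟩
    linarith [step2 θ K hK x hx]
  have hNs : 0 ≤ Nstar w := by
    have := (hNstar w).1 ⟨0, by rw [(hN0 0).2 rfl]; norm_num, rfl⟩
    simpa using this
  have step4 : (ρ' * Nstar w) * M ≤ r - E0 := by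
    refine aux_lub hMdef (mul_nonneg hρ'0 hNs) ?_
    rintro _ ⟨θ, K, hK, rfl⟩
    linarith [step3 θ K hK]
  linarith

/-- Theorem 4: the Wasserstein DRO problem
`min_{w} sup_{P ∈ P_{ρ,κ}} E^P[g(b aᵀ w)]` has the same optimal value as the convex
program `min ρλ + (1/n)Σ s_i` subject to `u_i = b_i a_iᵀ w`, `v_i = −u_i`,
`t_i = 2κλ + s_i`, `g(u_i) ≤ s_i`, `g(v_i) ≤ t_i`, `‖w‖_* ≤ λ/M`. -/
theorem dro_wasserstein_reformulation
    (d nn : ℕ) (hn : 0 < nn)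
    (a : Fin nn → EuclideanSpace ℝ (Fin d)) (bb : Fin nn → ℝ)
    (hbb : ∀ i, bb i = 1 ∨ bb i = -1)
    (g : ℝ → EReal)
    (hgproper : ∃ x, g x ≠ ⊤) (hgbot : ∀ x, g x ≠ ⊥)
    (hgconv : ∀ x y t : ℝ, 0 ≤ t → t ≤ 1 →
      g (t * x + (1 - t) * y) ≤ (t : EReal) * g x + ((1 - t : ℝ) : EReal) * g y)
    (hglsc : LowerSemicontinuous g)
    (M : ℝ) (hM : 0 < M)
    (hMdef : IsLUB {t : ℝ | ∃ θ : ℝ, econj g θ < ⊤ ∧ t = |θ|} M)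
    -- a general norm `N` on ℝ^d and its dual norm `Nstar`
    (N : EuclideanSpace ℝ (Fin d) → ℝ)
    (hN0 : ∀ x, N x = 0 ↔ x = 0)
    (hNsmul : ∀ (c : ℝ) x, N (c • x) = |c| * N x)
    (hNadd : ∀ x y, N (x + y) ≤ N x + N y)
    (hNcont : Continuous N)
    (Nstar : EuclideanSpace ℝ (Fin d) → ℝ)
    (hNstar : ∀ w, IsLUB {t : ℝ | ∃ x, N x ≤ 1 ∧ t = ⟪x, w⟫} (Nstar w))
    (κ ρ : ℝ) (hκ : 0 < κ) (hρ : 0 < ρ)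
    -- the empirical distribution
    (Q : Measure (EuclideanSpace ℝ (Fin d) × ℝ))
    (hQ : Q = ((nn : ℝ≥0∞))⁻¹ • ∑ i : Fin nn, Measure.dirac (a i, bb i)) :
    sInf {t : EReal | ∃ w : EuclideanSpace ℝ (Fin d),
        t = sSup {s : EReal | ∃ P : Measure (EuclideanSpace ℝ (Fin d) × ℝ),
              IsProbabilityMeasure P ∧
              P {z : EuclideanSpace ℝ (Fin d) × ℝ | z.2 = 1 ∨ z.2 = -1} = 1 ∧
              -- Wasserstein constraint `W(P, Q) ≤ ρ`
              sInf {W : ℝ≥0∞ |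
                  ∃ π : Measure ((EuclideanSpace ℝ (Fin d) × ℝ) × (EuclideanSpace ℝ (Fin d) × ℝ)),
                    IsProbabilityMeasure π ∧
                    π.map Prod.fst = P ∧ π.map Prod.snd = Q ∧
                    W = ∫⁻ pq, ENNReal.ofReal (N (pq.1.1 - pq.2.1) + κ * |pq.1.2 - pq.2.2|) ∂π}
                ≤ ENNReal.ofReal ρ ∧
              s = erealExp P (fun z => g (z.2 * ⟪z.1, w⟫))}}
      = sInf {t : EReal |
          ∃ (w : EuclideanSpace ℝ (Fin d)) (lam : ℝ) (u v s' t' : Fin nn → ℝ),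
            (∀ i, u i = bb i * ⟪a i, w⟫) ∧
            (∀ i, v i = -u i) ∧
            (∀ i, t' i = 2 * κ * lam + s' i) ∧
            (∀ i, g (u i) ≤ ((s' i : ℝ) : EReal)) ∧
            (∀ i, g (v i) ≤ ((t' i : ℝ) : EReal)) ∧
            Nstar w ≤ lam / M ∧
            t = ((ρ * lam + (1 / (nn : ℝ)) * ∑ i, s' i : ℝ) : EReal)} := by
  obtain ⟨f, rfl, hlip, hMdef'⟩ := aux_real hgproper hgbot hgconv hMdef
  rw [aux_Q nn hn] at hQ
  apply le_antisymm
  · refine le_sInf ?_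
    rintro _ ⟨w, lam, u, v, s', t', hu, hv, ht', hs1, hs2, hlam, rfl⟩
    refine sInf_le_of_le ⟨w, rfl⟩ ?_
    refine sSup_le ?_
    rintro _ ⟨P, hP1, hP2, hW, rfl⟩
    have hs1' : ∀ i, f (bb i * ⟪a i, w⟫) ≤ s' i := fun i => by
      rw [← hu i]; exact EReal.coe_le_coe_iff.1 (hs1 i)
    have hs2' : ∀ i, f (-(bb i * ⟪a i, w⟫)) ≤ 2 * κ * lam + s' i := fun i => by
      rw [← hu i, ← hv i, ← ht' i]; exact EReal.coe_le_coe_iff.1 (hs2 i)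
    have key : ∀ ε : ℝ, 0 < ε →
        Integrable (fun z : EuclideanSpace ℝ (Fin d) × ℝ => f (z.2 * ⟪z.1, w⟫)) P ∧
        ∫ z, f (z.2 * ⟪z.1, w⟫) ∂P ≤ (ρ + ε) * lam + (1 / (nn : ℝ)) * ∑ i, s' i := by
      intro ε hε
      have hlt := lt_of_le_of_lt hW
        ((ENNReal.ofReal_lt_ofReal_iff (show 0 < ρ + ε by linarith)).2 (show ρ < ρ + ε by linarith))
      obtain ⟨_, ⟨π, hπ, h1, h2, rfl⟩, hC⟩ := sInf_lt_iff.1 hlt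
      exact aux_weak_pi nn hn a bb hbb f M hM hlip hN0 hNsmul hNadd hNcont hNstar κ hκ w lam hlam s'
        hs1' hs2' P hP2 π h1 (h2.trans hQ) (ρ + ε) (by linarith) hC.le
    rw [aux_exp _ _ (key 1 one_pos).1, EReal.coe_le_coe_iff]
    have hc : Continuous fun ε : ℝ => (ρ + ε) * lam + (1 / (nn : ℝ)) * ∑ i, s' i := by fun_prop
    have ht := (hc.tendsto 0).mono_left (nhdsWithin_le_nhds (s := Set.Ioi 0))
    have := ge_of_tendsto ht (by
      filter_upwards [self_mem_nhdsWithin] with ε hε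
      exact (key ε hε).2)
    rw [add_zero] at this
    exact this
  · refine le_sInf ?_
    rintro _ ⟨w, rfl⟩
    obtain ⟨lam, hL, p, hp, hpρ, hval⟩ := aux_knap nn hn
      (fun i => f (-(bb i * ⟪a i, w⟫)) - f (bb i * ⟪a i, w⟫)) (M * Nstar w) κ ρ hκ hρ
    refine sInf_le_of_le ⟨w, lam, fun i => bb i * ⟪a i, w⟫, fun i => -(bb i * ⟪a i, w⟫),
      fun i => f (bb i * ⟪a i, w⟫)
        + max 0 (f (-(bb i * ⟪a i, w⟫)) - f (bb i * ⟪a i, w⟫) - 2 * κ * lam),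
      fun i => 2 * κ * lam + (f (bb i * ⟪a i, w⟫)
        + max 0 (f (-(bb i * ⟪a i, w⟫)) - f (bb i * ⟪a i, w⟫) - 2 * κ * lam)),
      fun _ => rfl, fun _ => rfl, fun _ => rfl, fun i => ?_, fun i => ?_, ?_, rfl⟩ ?_
    · rw [EReal.coe_le_coe_iff]
      linarith [le_max_left 0 (f (-(bb i * ⟪a i, w⟫)) - f (bb i * ⟪a i, w⟫) - 2 * κ * lam)]
    · rw [EReal.coe_le_coe_iff]
      linarith [le_max_right 0 (f (-(bb i * ⟪a i, w⟫)) - f (bb i * ⟪a i, w⟫) - 2 * κ * lam)]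
    · rw [le_div_iff₀ hM]; linarith
    · by_contra hlt
      obtain ⟨r, hr1, hr2⟩ := EReal.lt_iff_exists_real_btwn.1 (not_le.1 hlt)
      rw [EReal.coe_lt_coe_iff] at hr2
      have := aux_strong nn hn a bb hbb f M hMdef' hN0 hNsmul hNadd hNstar κ ρ hκ Q hQ w r
        (fun P hP => le_trans (by
          apply le_sSup
          exact ⟨P, hP.1, hP.2.1, hP.2.2, rfl⟩) hr1.le) p hp hpρ
      rw [Finset.sum_add_distrib, mul_add] at this hr2
      linarith
end

section
/- Let (a′, b′) ∈ ℝ^d × {1, −1}, w ∈ ℝ^d, and λ > 0. Then, as an extended real number, sup_{a∈ℝ^d} ( g(b′ aᵀ w) − λ‖a − a′‖ ) equals g(b′ (a′)ᵀ w) if ‖w‖_* ≤ λ/M, and equals +∞ otherwise. -/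
open scoped RealInnerProductSpace BigOperators

theorem econj_lt_top_iff' (g : ℝ → EReal) (hgbot : ∀ x, g x ≠ ⊥) (θ : ℝ) :
    econj g θ < ⊤ ↔ ∃ c : ℝ, ∀ z : ℝ, ((θ * z - c : ℝ) : EReal) ≤ g z := by
  constructor
  · intro h
    obtain ⟨c, hc, -⟩ := EReal.lt_iff_exists_real_btwn.1 h
    refine ⟨c, fun z => ?_⟩
    have h1 : ((θ * z : ℝ) : EReal) - g z ≤ (c : EReal) :=
      (le_iSup (fun x : ℝ => ((θ * x : ℝ) : EReal) - g x) z).trans hc.le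
    have hb := hgbot z
    generalize g z = u at h1 hb
    induction u using EReal.rec with
    | bot => exact absurd rfl hb
    | top => exact le_top
    | coe r =>
      rw [← EReal.coe_sub, EReal.coe_le_coe_iff] at h1
      rw [EReal.coe_le_coe_iff]
      linarith
  · rintro ⟨c, hc⟩
    refine lt_of_le_of_lt (iSup_le fun z => ?_) (EReal.coe_lt_top c)
    have h1 := hc z
    have hb := hgbot z
    generalize g z = u at h1 hb
    induction u using EReal.rec with
    | bot => exact absurd rfl hb
    | top => simp
    | coe r =>
      rw [EReal.coe_le_coe_iff] at h1
      rw [← EReal.coe_sub, EReal.coe_le_coe_iff]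
      linarith

theorem g_lipschitz_aux (g : ℝ → EReal) (hgbot : ∀ x, g x ≠ ⊥)
    (hgconv : ∀ x y t : ℝ, 0 ≤ t → t ≤ 1 →
      g (t * x + (1 - t) * y) ≤ (t : EReal) * g x + ((1 - t : ℝ) : EReal) * g y)
    (M : ℝ) (hM : 0 < M)
    (hMdef : IsLUB {t : ℝ | ∃ θ : ℝ, econj g θ < ⊤ ∧ t = |θ|} M)
    (x y a : ℝ) (hx : g x = (a : EReal)) : g y ≤ ((a + M * |y - x| : ℝ) : EReal) := by
  by_contra hcon
  push Not at hcon
  obtain ⟨m, hm1, hm2⟩ := EReal.lt_iff_exists_real_btwn.1 hcon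
  rw [EReal.coe_lt_coe_iff] at hm1
  obtain ⟨t0, ⟨θ, hθ, rfl⟩, -⟩ := (lt_isLUB_iff hMdef).1 hM
  have hθM : |θ| ≤ M := hMdef.1 ⟨θ, hθ, rfl⟩
  obtain ⟨c, hc⟩ := (econj_lt_top_iff' g hgbot θ).1 hθ
  have hne : y - x ≠ 0 := by
    intro h
    have : y = x := by linarith
    subst this
    rw [hx, EReal.coe_lt_coe_iff] at hm2
    simp at hm1
    linarith
  obtain ⟨e, he⟩ : ∃ e, e = y - x := ⟨_, rfl⟩
  have hy : y = x + e := by linarith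
  rw [← he] at hne hm1
  set p : ℝ := (m - a) / e with hp
  have hpe : p * e = m - a := by rw [hp]; field_simp
  have hpM : M < |p| := by
    have h1 : M * |e| < |p| * |e| := by
      rw [← abs_mul, hpe]
      exact lt_of_lt_of_le (by linarith) (le_abs_self _)
    exact lt_of_mul_lt_mul_right h1 (abs_nonneg _)
  have hθe : θ * e ≤ p * e := by
    have h1 : θ * e ≤ |θ| * |e| := by rw [← abs_mul]; exact le_abs_self _
    have h2 : |θ| * |e| ≤ M * |e| := mul_le_mul_of_nonneg_right hθM (abs_nonneg _)
    linarith
  have hfin : econj g p < ⊤ := by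
    rw [econj_lt_top_iff' g hgbot]
    refine ⟨max (p * x - a) (c + (p - θ) * y), fun z => ?_⟩
    obtain ⟨k, hk⟩ : ∃ k, z = x + k * e := ⟨(z - x) / e, by field_simp; ring⟩
    rcases le_total k 1 with hk1 | hk1
    · refine le_trans ?_ (hc z)
      rw [EReal.coe_le_coe_iff]
      have := le_max_right (p * x - a) (c + (p - θ) * y)
      have h3 : (p - θ) * z ≤ (p - θ) * y := by
        rw [hk, hy]
        nlinarith
      linarith
    · have hk0 : 0 < k := by linarith
      have hcv := hgconv z x (1 / k) (by positivity) (by rw [div_le_one hk0]; exact hk1)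
      have hyy : 1 / k * z + (1 - 1 / k) * x = y := by
        rw [hk, hy]; field_simp; ring
      rw [hyy, hx] at hcv
      have hlt := lt_of_lt_of_le hm2 hcv
      have hb := hgbot z
      generalize g z = u at hlt hb
      induction u using EReal.rec with
      | bot => exact absurd rfl hb
      | top => exact le_top
      | coe r =>
        rw [← EReal.coe_mul, ← EReal.coe_mul, ← EReal.coe_add, EReal.coe_lt_coe_iff] at hlt
        rw [EReal.coe_le_coe_iff]
        have := le_max_left (p * x - a) (c + (p - θ) * y)
        have h4 : k * m < r + (k - 1) * a := by
          have h5 := mul_lt_mul_of_pos_left hlt hk0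
          have h6 : k * (1 / k * r + (1 - 1 / k) * a) = r + (k - 1) * a := by
            field_simp
          linarith
        have h7 : p * z = p * x + k * (m - a) := by rw [hk, ← hpe]; ring
        linarith
  have := hMdef.1 ⟨p, hfin, rfl⟩
  linarith

/-- Lemma: for `λ > 0`,
`sup_{a ∈ ℝ^d} ( g(b′ aᵀw) − λ‖a − a′‖ )` equals `g(b′ (a′)ᵀ w)` if `‖w‖_* ≤ λ/M`
and `+∞` otherwise, where `M = sup{|θ| : θ ∈ dom g*}`. -/
theorem sup_translate_loss
    (d : ℕ)
    (g : ℝ → EReal)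
    (hgproper : ∃ x, g x ≠ ⊤) (hgbot : ∀ x, g x ≠ ⊥)
    (hgconv : ∀ x y t : ℝ, 0 ≤ t → t ≤ 1 →
      g (t * x + (1 - t) * y) ≤ (t : EReal) * g x + ((1 - t : ℝ) : EReal) * g y)
    (hglsc : LowerSemicontinuous g)
    (M : ℝ) (hM : 0 < M)
    (hMdef : IsLUB {t : ℝ | ∃ θ : ℝ, econj g θ < ⊤ ∧ t = |θ|} M)
    -- a general norm `N` on ℝ^d and its dual norm `Nstar`
    (N : EuclideanSpace ℝ (Fin d) → ℝ)
    (hN0 : ∀ x, N x = 0 ↔ x = 0)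
    (hNsmul : ∀ (c : ℝ) x, N (c • x) = |c| * N x)
    (hNadd : ∀ x y, N (x + y) ≤ N x + N y)
    (Nstar : EuclideanSpace ℝ (Fin d) → ℝ)
    (hNstar : ∀ w, IsLUB {t : ℝ | ∃ x, N x ≤ 1 ∧ t = ⟪x, w⟫} (Nstar w))
    (a' : EuclideanSpace ℝ (Fin d)) (b' : ℝ) (hb' : b' = 1 ∨ b' = -1)
    (w : EuclideanSpace ℝ (Fin d)) (lam : ℝ) (hlam : 0 < lam) :
    (Nstar w ≤ lam / M →
      (⨆ aa : EuclideanSpace ℝ (Fin d),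
          (g (b' * ⟪aa, w⟫) - ((lam * N (aa - a') : ℝ) : EReal)))
        = g (b' * ⟪a', w⟫)) ∧
    (¬ Nstar w ≤ lam / M →
      (⨆ aa : EuclideanSpace ℝ (Fin d),
          (g (b' * ⟪aa, w⟫) - ((lam * N (aa - a') : ℝ) : EReal)))
        = ⊤) := by
  have hNz : N 0 = 0 := (hN0 0).2 rfl
  have hNneg : ∀ x, N (-x) = N x := fun x => by
    have := hNsmul (-1) x
    simpa using this
  have hNnn : ∀ x, 0 ≤ N x := fun x => by
    have := hNadd x (-x)
    rw [add_neg_cancel, hNz, hNneg] at this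
    linarith
  have hdual : ∀ v, ⟪v, w⟫ ≤ Nstar w * N v := fun v => by
    by_cases hv : v = 0
    · subst hv; simp [hNz]
    · have hpos : 0 < N v := lt_of_le_of_ne (hNnn v) (fun h => hv ((hN0 v).1 h.symm))
      have h1 : ⟪(N v)⁻¹ • v, w⟫ ≤ Nstar w := (hNstar w).1
        ⟨(N v)⁻¹ • v, by rw [hNsmul, abs_of_pos (inv_pos.2 hpos), inv_mul_cancel₀ hpos.ne'], rfl⟩
      rw [real_inner_smul_left, inv_mul_le_iff₀ hpos] at h1
      linarith
  have hdual' : ∀ v, |⟪v, w⟫| ≤ Nstar w * N v := fun v => by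
    rw [abs_le]
    have h1 := hdual (-v)
    rw [inner_neg_left, hNneg] at h1
    exact ⟨by linarith, hdual v⟩
  have hbabs : |b'| = 1 := by rcases hb' with h | h <;> simp [h]
  constructor
  · intro hle
    rw [le_div_iff₀ hM] at hle
    apply le_antisymm
    · refine iSup_le fun aa => ?_
      rcases eq_or_ne (g (b' * ⟪a', w⟫)) ⊤ with htop | htop
      · rw [htop]; exact le_top
      · obtain ⟨r, hr⟩ : ∃ r : ℝ, g (b' * ⟪a', w⟫) = (r : EReal) :=
          ⟨_, (EReal.coe_toReal htop (hgbot _)).symm⟩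
        have hL := g_lipschitz_aux g hgbot hgconv M hM hMdef _ (b' * ⟪aa, w⟫) r hr
        have hd : |b' * ⟪aa, w⟫ - b' * ⟪a', w⟫| ≤ Nstar w * N (aa - a') := by
          rw [← mul_sub, abs_mul, hbabs, one_mul, ← inner_sub_left]
          exact hdual' _
        have h2 : M * |b' * ⟪aa, w⟫ - b' * ⟪a', w⟫| ≤ lam * N (aa - a') := by
          have h3 := mul_le_mul_of_nonneg_left hd hM.le
          have h4 := mul_le_mul_of_nonneg_right hle (hNnn (aa - a'))
          linarith
        rw [hr]
        refine (EReal.sub_le_sub hL le_rfl).trans ?_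
        rw [← EReal.coe_sub, EReal.coe_le_coe_iff]
        linarith
    · refine le_trans ?_ (le_iSup _ a')
      simp [hNz]
  · intro hlt
    push Not at hlt
    obtain ⟨_, ⟨x, hx1, rfl⟩, hx⟩ := (lt_isLUB_iff (hNstar w)).1 hlt
    have hxpos : 0 < ⟪x, w⟫ := lt_trans (by positivity) hx
    have hx' : lam / ⟪x, w⟫ < M := by
      rw [div_lt_iff₀ hM] at hx
      rw [div_lt_iff₀ hxpos]
      linarith
    obtain ⟨_, ⟨θ, hθ, rfl⟩, hθ2⟩ := (lt_isLUB_iff hMdef).1 hx'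
    rw [div_lt_iff₀ hxpos] at hθ2
    obtain ⟨c, hc⟩ := (econj_lt_top_iff' g hgbot θ).1 hθ
    obtain ⟨s, hs1, hs2⟩ : ∃ s : ℝ, |s| = 1 ∧ θ * b' * s = |θ| := by
      have h0 : |θ * b'| = |θ| := by rw [abs_mul, hbabs, mul_one]
      rcases le_total 0 (θ * b') with h | h
      · exact ⟨1, by simp, by rw [← h0, abs_of_nonneg h, mul_one]⟩
      · exact ⟨-1, by simp, by rw [← h0, abs_of_nonpos h]; ring⟩
    rw [EReal.eq_top_iff_forall_lt]
    intro K
    set δ := |θ| * ⟪x, w⟫ - lam with hδ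
    have hδpos : 0 < δ := by linarith
    set C := θ * (b' * ⟪a', w⟫) - c with hC
    set t := (|K - C| + 1) / δ with ht
    have ht0 : 0 < t := by positivity
    have htδ : t * δ = |K - C| + 1 := by rw [ht]; field_simp
    refine lt_of_lt_of_le ?_ (le_iSup _ (a' + (t * s) • x))
    refine lt_of_lt_of_le ?_ (EReal.sub_le_sub (hc _) le_rfl)
    rw [← EReal.coe_sub, EReal.coe_lt_coe_iff, add_sub_cancel_left, hNsmul, abs_mul, hs1,
      abs_of_pos ht0, inner_add_left, real_inner_smul_left]
    have e1 : θ * (b' * (⟪a', w⟫ + t * s * ⟪x, w⟫)) - c = C + t * (|θ| * ⟪x, w⟫) := by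
      rw [← hs2, hC]; ring
    rw [e1]
    have e2 : lam * (t * 1 * N x) ≤ t * lam := by
      have := mul_le_mul_of_nonneg_left hx1 (mul_pos hlam ht0).le
      linarith
    have e3 : t * δ = t * (|θ| * ⟪x, w⟫) - t * lam := by rw [hδ]; ring
    have := le_abs_self (K - C)
    linarith
end
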